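/- The elliptic (theta-hypergeometric) analogue of Jackson's summation: for n ∈ ℕ, complex numbers p, q with |p| < 1, 0 < |q| < 1, and nonzero complex numbers a, b, c, d such that no factor θ(x;p) occurring in any denominator below vanishes, one has ∑_{k=0}^n (θ(a q^{2k};p)/θ(a;p)) · ((a;q,p)_k (b;q,p)_k (c;q,p)_k (d;q,p)_k (q^{n+1}a²/(bcd);q,p)_k (q^{−n};q,p)_k) / ((q;q,p)_k (qa/b;q,p)_k (qa/c;q,p)_k (qa/d;q,p)_k (q^{−n}bcd/a;q,p)_k (q^{n+1}a;q,p)_k) · q^k = ((qa;q,p)_n (qa/(bc);q,p)_n (qa/(bd);q,p)_n (qa/(cd);q,p)_n) / ((qa/b;q,p)_n (qa/c;q,p)_n (qa/d;q,p)_n (qa/(bcd);q,p)_n). -/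

import Mathlib

/-- The infinite `p`-shifted factorial `(a;p)_∞`. -/
noncomputable def qPochInf (a p : ℂ) : ℂ := ∏' j : ℕ, (1 - a * p ^ j)

/-- The modified Jacobi theta function `θ(x;p) = (x;p)_∞ (p/x;p)_∞`. -/
noncomputable def jTheta (x p : ℂ) : ℂ := qPochInf x p * qPochInf (p / x) p

/-- The elliptic shifted factorial `(a;q,p)_k = ∏_{j=0}^{k-1} θ(aq^j;p)`. -/
noncomputable def ePoch (a q p : ℂ) (k : ℕ) : ℂ := ∏ j ∈ Finset.range k, jTheta (a * q ^ j) p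

open Filter Topology

lemma summable_norm_mul_pow (a : ℂ) {p : ℂ} (hp : ‖p‖ < 1) : Summable fun j : ℕ ↦ ‖-(a * p ^ j)‖ := by
  simpa [norm_mul, norm_pow] using (summable_geometric_of_lt_one (norm_nonneg p) hp).mul_left ‖a‖

lemma multipliable_one_sub_mul_pow (a : ℂ) {p : ℂ} (hp : ‖p‖ < 1) :
    Multipliable fun j : ℕ ↦ 1 - a * p ^ j := by
  simpa [sub_eq_add_neg] using multipliable_one_add_of_summable (summable_norm_mul_pow a hp)

lemma tendsto_prod_qPochInf (a : ℂ) {p : ℂ} (hp : ‖p‖ < 1) :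
    Tendsto (fun n ↦ ∏ j ∈ Finset.range n, (1 - a * p ^ j)) atTop (𝓝 (qPochInf a p)) :=
  (multipliable_one_sub_mul_pow a hp).hasProd.tendsto_prod_nat

lemma qPochInf_eq_mul (a : ℂ) {p : ℂ} (hp : ‖p‖ < 1) :
    qPochInf a p = (1 - a) * qPochInf (p * a) p := by
  have e (j : ℕ) : a * p ^ (j + 1) = p * a * p ^ j := by ring
  have h : Multipliable fun j : ℕ ↦ 1 - a * p ^ (j + 1) := by
    simp only [e]
    exact multipliable_one_sub_mul_pow (p * a) hp
  have h2 := tprod_eq_zero_mul' (f := fun j : ℕ ↦ 1 - a * p ^ j) h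
  simp only [e, pow_zero, mul_one] at h2
  exact h2

lemma qPochInf_ne_zero {a p : ℂ} (hp : ‖p‖ < 1) (h : ∀ j : ℕ, 1 - a * p ^ j ≠ 0) :
    qPochInf a p ≠ 0 := by
  simpa [qPochInf, sub_eq_add_neg] using
    tprod_one_add_ne_zero_of_summable (f := fun j : ℕ ↦ -(a * p ^ j))
      (by simpa [sub_eq_add_neg] using h) (summable_norm_mul_pow a hp)

lemma continuous_qPochInf {p : ℂ} (hp : ‖p‖ < 1) : Continuous fun a ↦ qPochInf a p := by
  rw [continuous_iff_continuousAt]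
  intro a
  have hu : Summable fun j : ℕ ↦ (‖a‖ + 1) * ‖p‖ ^ j :=
    (summable_geometric_of_lt_one (norm_nonneg p) hp).mul_left _
  have h := Summable.hasProdLocallyUniformlyOn_nat_one_add (K := Metric.ball a 1)
    (f := fun (j : ℕ) (x : ℂ) ↦ -(x * p ^ j)) Metric.isOpen_ball hu
    (Eventually.of_forall fun j x hx ↦ by
      rw [norm_neg, norm_mul, norm_pow]
      gcongr
      have h1 : ‖x - a‖ < 1 := by simpa [dist_eq_norm] using hx
      have h2 := norm_add_le a (x - a)
      rw [add_sub_cancel] at h2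
      linarith) (fun j ↦ by fun_prop)
  have h2 := h.tendstoLocallyUniformlyOn_finsetRange.continuousOn
    (Frequently.of_forall fun n ↦ by fun_prop)
  have h3 := h2.continuousAt (Metric.ball_mem_nhds a one_pos)
  simpa [qPochInf, sub_eq_add_neg] using h3

lemma continuousAt_jTheta {x p : ℂ} (hp : ‖p‖ < 1) (hx : x ≠ 0) :
    ContinuousAt (fun y ↦ jTheta y p) x := by
  have h := continuous_qPochInf hp
  exact h.continuousAt.mul
    (h.continuousAt.comp (f := fun y ↦ p / y) (continuousAt_const.div continuousAt_id hx))

lemma jTheta_inv {x p : ℂ} (hp : ‖p‖ < 1) (hx : x ≠ 0) :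
    jTheta x⁻¹ p = -x⁻¹ * jTheta x p := by
  have h1 := qPochInf_eq_mul x⁻¹ hp
  have h2 := qPochInf_eq_mul x hp
  rw [jTheta, jTheta, h1, h2, div_inv_eq_mul, div_eq_mul_inv]
  field_simp
  ring

lemma jTheta_one {p : ℂ} (hp : ‖p‖ < 1) : jTheta 1 p = 0 := by
  rw [jTheta, qPochInf_eq_mul 1 hp]
  simp

lemma jTheta_zero_right (x : ℂ) : jTheta x 0 = 1 - x := by
  have h (a : ℂ) : qPochInf a 0 = 1 - a := by
    rw [qPochInf_eq_mul a (by simp)]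
    simp [qPochInf]
  simp [jTheta, h]

lemma countable_jTheta_zeros {p : ℂ} (hp : ‖p‖ < 1) :
    {x : ℂ | x ≠ 0 ∧ jTheta x p = 0}.Countable := by
  refine ((Set.countable_range fun j : ℕ ↦ (p ^ j)⁻¹).union
    (Set.countable_range fun j : ℕ ↦ p ^ (j + 1))).mono ?_
  rintro x ⟨hx, h⟩
  rcases mul_eq_zero.1 h with h | h
  · left
    by_contra hn
    refine qPochInf_ne_zero hp (fun j hj ↦ hn ⟨j, ?_⟩) h
    exact (eq_inv_of_mul_eq_one_left (sub_eq_zero.1 hj).symm).symm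
  · right
    by_contra hn
    refine qPochInf_ne_zero hp (fun j hj ↦ hn ⟨j, ?_⟩) h
    have h1 : x = x * (p / x * p ^ j) := by rw [← sub_eq_zero.1 hj, mul_one]
    rw [h1]
    field_simp
    ring

/-- `1 / (p;p)_k`, extended by zero to negative `k`. -/
noncomputable def qFactInv (p : ℂ) (k : ℤ) : ℂ :=
  if 0 ≤ k then (∏ j ∈ Finset.range k.toNat, (1 - p * p ^ j))⁻¹ else 0

/-- The coefficient `(-1)^k p^{k(k-1)/2}` of the theta series. -/
noncomputable def thetaCoeff (p : ℂ) (k : ℤ) : ℂ := (-1) ^ k * p ^ (k * (k - 1) / 2)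

lemma one_sub_mul_pow_ne_zero {p : ℂ} (hp : ‖p‖ < 1) (j : ℕ) : 1 - p * p ^ j ≠ 0 := by
  intro h
  have h1 : ‖p * p ^ j‖ = 1 := by rw [← sub_eq_zero.1 h, norm_one]
  rw [← pow_succ', norm_pow] at h1
  exact (pow_lt_one₀ (norm_nonneg p) hp j.succ_ne_zero).ne h1

lemma qFactInv_eq {p : ℂ} (hp : ‖p‖ < 1) (k : ℤ) :
    qFactInv p k = (1 - p ^ (k + 1)) * qFactInv p (k + 1) := by
  rcases lt_trichotomy (k + 1) 0 with h | h | h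
  · rw [qFactInv, qFactInv, if_neg (by lia), if_neg (by lia), mul_zero]
  · rw [qFactInv, if_neg (by lia), h]
    simp
  · lift k to ℕ using by lia
    have h1 : ((k : ℤ) + 1).toNat = k + 1 := by lia
    rw [qFactInv, qFactInv, if_pos (by lia), if_pos (by lia), h1, Finset.prod_range_succ,
      Int.toNat_natCast, ← pow_succ', mul_inv]
    have h2 := one_sub_mul_pow_ne_zero hp k
    rw [← pow_succ'] at h2
    rw [show p ^ ((k : ℤ) + 1) = p ^ (k + 1) by norm_cast]
    field_simp

lemma thetaCoeff_succ {p : ℂ} (h0 : p ≠ 0) (k : ℤ) :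
    thetaCoeff p (k + 1) = -p ^ k * thetaCoeff p k := by
  have h : (k + 1) * (k + 1 - 1) / 2 = k * (k - 1) / 2 + k := by
    rw [show (k + 1) * (k + 1 - 1) = k * (k - 1) + k * 2 by ring,
      Int.add_mul_ediv_right _ _ two_ne_zero]
  rw [thetaCoeff, thetaCoeff, h, zpow_add₀ h0, zpow_add₀ (by norm_num)]
  simp
  ring

/-- The finite form of the Jacobi triple product identity. -/
lemma hasSum_finite_triple_product {p : ℂ} (hp : ‖p‖ < 1) (h0 : p ≠ 0) {x : ℂ} (hx : x ≠ 0)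
    (m n : ℕ) :
    HasSum (fun k : ℤ ↦ thetaCoeff p k * x ^ k *
        ((∏ j ∈ Finset.range (m + n), (1 - p * p ^ j)) * qFactInv p (n + k) * qFactInv p (m - k)))
      ((∏ j ∈ Finset.range m, (1 - x * p ^ j)) * ∏ j ∈ Finset.range n, (1 - p / x * p ^ j)) := by
  induction n with
  | zero =>
    induction m with
    | zero =>
      convert hasSum_ite_eq (0 : ℤ) (1 : ℂ) using 1
      · ext k
        rcases lt_trichotomy k 0 with h | rfl | h
        · simp [qFactInv, h.ne, h]
        · simp [qFactInv, thetaCoeff]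
        · simp [qFactInv, h.ne', h]
      · simp
    | succ m ih =>
      have ih2 := ((Equiv.subRight (1 : ℤ)).hasSum_iff.2 ih).mul_left (-(x * p ^ m))
      convert ih.add ih2 using 1
      · ext k
        obtain ⟨k, rfl⟩ : ∃ l, k = l + 1 := ⟨k - 1, by ring⟩
        have e1 := qFactInv_eq hp (m - (k + 1))
        have e2 := qFactInv_eq hp k
        simp only [Function.comp, Equiv.subRight_apply, Nat.add_zero, Nat.cast_zero, zero_add,
          Finset.prod_range_succ, thetaCoeff_succ h0, add_sub_cancel_right]
        rw [show (m : ℤ) - (k + 1) + 1 = m - k by ring] at e1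
        rw [show ((m + 1 : ℕ) : ℤ) - (k + 1) = m - k by push_cast; ring, e1, e2, zpow_add₀ hx,
          zpow_add₀ h0, zpow_sub₀ h0]
        simp only [zpow_natCast, zpow_one]
        have := zpow_ne_zero k h0
        field_simp
        ring
      · rw [Finset.prod_range_succ]
        ring
  | succ n ih =>
    have ih2 := ((Equiv.addRight (1 : ℤ)).hasSum_iff.2 ih).mul_left (-(p / x * p ^ n))
    convert ih.add ih2 using 1
    · ext k
      have e1 := qFactInv_eq hp (m - (k + 1))
      have e2 := qFactInv_eq hp (n + k)
      simp only [Function.comp, Equiv.coe_addRight, ← Nat.add_assoc,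
        Finset.prod_range_succ, thetaCoeff_succ h0]
      rw [show (m : ℤ) - (k + 1) + 1 = m - k by ring] at e1
      rw [show (n : ℤ) + (k + 1) = n + k + 1 by ring,
        show ((n + 1 : ℕ) : ℤ) + k = n + k + 1 by push_cast; ring, e1, e2, zpow_add₀ hx,
        zpow_add₀ h0, zpow_add₀ h0, zpow_sub₀ h0, pow_add]
      simp only [zpow_natCast, zpow_one]
      have := zpow_ne_zero k h0
      field_simp
      ring
    · rw [Finset.prod_range_succ _ n]
      ring

lemma thetaCoeff_ne_zero {p : ℂ} (h0 : p ≠ 0) (k : ℤ) : thetaCoeff p k ≠ 0 :=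
  mul_ne_zero (zpow_ne_zero _ (by norm_num)) (zpow_ne_zero _ h0)

lemma summable_nat_thetaCoeff {p : ℂ} (hp : ‖p‖ < 1) (h0 : p ≠ 0) {x : ℂ} (hx : x ≠ 0) :
    Summable fun k : ℕ ↦ ‖thetaCoeff p k * x ^ (k : ℤ)‖ := by
  refine summable_of_ratio_test_tendsto_lt_one zero_lt_one (Eventually.of_forall fun k ↦
    norm_ne_zero_iff.2 (mul_ne_zero (thetaCoeff_ne_zero h0 _) (zpow_ne_zero _ hx))) ?_
  have h : Tendsto (fun k : ℕ ↦ ‖p‖ ^ k * ‖x‖) atTop (𝓝 0) := by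
    simpa using (tendsto_pow_atTop_nhds_zero_of_lt_one (norm_nonneg p) hp).mul_const ‖x‖
  refine h.congr fun k ↦ ?_
  have h1 := norm_ne_zero_iff.2 (thetaCoeff_ne_zero h0 k)
  have h2 := norm_ne_zero_iff.2 hx
  push_cast
  rw [thetaCoeff_succ h0, zpow_add₀ hx]
  simp only [zpow_natCast, zpow_one, norm_norm, norm_mul, norm_neg, norm_pow]
  field_simp

lemma summable_thetaCoeff {p : ℂ} (hp : ‖p‖ < 1) (h0 : p ≠ 0) {x : ℂ} (hx : x ≠ 0) :
    Summable fun k : ℤ ↦ ‖thetaCoeff p k * x ^ k‖ := by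
  refine Summable.of_nat_of_neg (summable_nat_thetaCoeff hp h0 hx) ?_
  refine (summable_nat_thetaCoeff hp h0 (x := p / x) (div_ne_zero h0 hx)).congr fun k ↦ ?_
  have h : -(k : ℤ) * (-k - 1) / 2 = k * (k - 1) / 2 + k := by
    rw [show -(k : ℤ) * (-k - 1) = k * (k - 1) + k * 2 by ring,
      Int.add_mul_ediv_right _ _ two_ne_zero]
  rw [thetaCoeff, thetaCoeff, h, zpow_add₀ h0]
  simp only [norm_mul, norm_zpow, norm_neg, norm_one, one_zpow, zpow_neg, norm_inv, norm_div,
    div_zpow]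
  ring

lemma qPochInf_self_ne_zero {p : ℂ} (hp : ‖p‖ < 1) : qPochInf p p ≠ 0 :=
  qPochInf_ne_zero hp (one_sub_mul_pow_ne_zero hp)

lemma tendsto_qFactInv {p : ℂ} (hp : ‖p‖ < 1) : Tendsto (qFactInv p) atTop (𝓝 (qPochInf p p)⁻¹) := by
  have h := ((tendsto_prod_qPochInf p hp).comp
    (tendsto_atTop_atTop.2 fun b ↦ ⟨b, fun a ha ↦ by lia⟩ : Tendsto Int.toNat atTop atTop)).inv₀
    (qPochInf_self_ne_zero hp)
  refine h.congr' ?_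
  filter_upwards [eventually_ge_atTop 0] with k hk
  simp [qFactInv, hk]

lemma exists_norm_qFactInv_le {p : ℂ} (hp : ‖p‖ < 1) : ∃ R, ∀ k, ‖qFactInv p k‖ ≤ R := by
  have h := (tendsto_prod_qPochInf p hp).inv₀ (qPochInf_self_ne_zero hp)
  obtain ⟨R, hR⟩ := (Metric.isBounded_range_of_tendsto _ h).exists_norm_le
  refine ⟨R, fun k ↦ ?_⟩
  have hR' (n : ℕ) : ‖(∏ j ∈ Finset.range n, (1 - p * p ^ j))⁻¹‖ ≤ R := hR _ ⟨n, rfl⟩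
  rw [qFactInv]
  split_ifs
  · exact hR' _
  · simpa using (norm_nonneg _).trans (hR' 0)

/-- The Jacobi triple product identity. -/
lemma tsum_thetaCoeff {p : ℂ} (hp : ‖p‖ < 1) (h0 : p ≠ 0) {x : ℂ} (hx : x ≠ 0) :
    ∑' k : ℤ, thetaCoeff p k * x ^ k = qPochInf p p * jTheta x p := by
  have hP := qPochInf_self_ne_zero hp
  obtain ⟨R, hR⟩ := exists_norm_qFactInv_le hp
  have hR0 : 0 ≤ R := (norm_nonneg _).trans (hR 0)
  have hprod := tendsto_prod_qPochInf p hp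
  obtain ⟨Q, hQ⟩ := (Metric.isBounded_range_of_tendsto _ hprod).exists_norm_le
  have hQ' (n : ℕ) : ‖∏ j ∈ Finset.range n, (1 - p * p ^ j)‖ ≤ Q := hQ _ ⟨n, rfl⟩
  have hQ0 : 0 ≤ Q := (norm_nonneg _).trans (hQ' 0)
  have hdouble : Tendsto (fun n : ℕ ↦ n + n) atTop atTop :=
    tendsto_atTop_atTop.2 fun b ↦ ⟨b, fun a ha ↦ by lia⟩
  have hlim := tendsto_tsum_of_dominated_convergence (𝓕 := atTop)
    (f := fun (n : ℕ) (k : ℤ) ↦ thetaCoeff p k * x ^ k *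
      ((∏ j ∈ Finset.range (n + n), (1 - p * p ^ j)) * qFactInv p (n + k) * qFactInv p (n - k)))
    (g := fun k ↦ thetaCoeff p k * x ^ k *
      (qPochInf p p * (qPochInf p p)⁻¹ * (qPochInf p p)⁻¹))
    (bound := fun k ↦ ‖thetaCoeff p k * x ^ k‖ * (Q * R * R))
    ((summable_thetaCoeff hp h0 hx).mul_right _)
    (fun k ↦ tendsto_const_nhds.mul (((hprod.comp hdouble).mul
      ((tendsto_qFactInv hp).comp (tendsto_atTop_add_const_right _ _
        tendsto_natCast_atTop_atTop))).mul ((tendsto_qFactInv hp).comp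
          (tendsto_atTop_add_const_right _ (-k) tendsto_natCast_atTop_atTop))))
    (Eventually.of_forall fun n k ↦ by
      simp only [norm_mul]
      gcongr
      · exact hQ' _
      · exact hR _
      · exact hR _)
  have h1 : Tendsto (fun n : ℕ ↦ (∏ j ∈ Finset.range n, (1 - x * p ^ j)) *
      ∏ j ∈ Finset.range n, (1 - p / x * p ^ j)) atTop (𝓝 (jTheta x p)) :=
    (tendsto_prod_qPochInf x hp).mul (tendsto_prod_qPochInf (p / x) hp)
  have h2 := tendsto_nhds_unique hlim
    (h1.congr fun n ↦ (hasSum_finite_triple_product hp h0 hx n n).tsum_eq.symm)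
  rw [tsum_mul_right] at h2
  rw [← h2]
  field_simp

lemma tsum_int_prod_eq_add {f : ℤ × ℤ → ℂ} (hf : Summable f) :
    ∑' z, f z = ∑' z : ℤ × ℤ, f (z.1 + z.2, z.1 - z.2) +
      ∑' z : ℤ × ℤ, f (z.1 + z.2 + 1, z.1 - z.2) := by
  set g : ℤ × ℤ → ℤ × ℤ := fun z ↦ (z.1 + z.2, z.1 - z.2) with hg
  set g' : ℤ × ℤ → ℤ × ℤ := fun z ↦ (z.1 + z.2 + 1, z.1 - z.2) with hg'
  have hi : g.Injective := by
    rintro ⟨a, b⟩ ⟨c, d⟩ h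
    simp only [hg, Prod.mk.injEq] at h ⊢
    lia
  have hi' : g'.Injective := by
    rintro ⟨a, b⟩ ⟨c, d⟩ h
    simp only [hg', Prod.mk.injEq] at h ⊢
    lia
  have hc : IsCompl (Set.range g) (Set.range g') := by
    refine ⟨?_, ?_⟩
    · rw [Set.disjoint_left]
      rintro _ ⟨z, rfl⟩ ⟨w, h⟩
      simp only [hg, hg', Prod.mk.injEq] at h
      lia
    · refine codisjoint_iff.2 (Set.eq_univ_iff_forall.2 ?_)
      rintro ⟨m, n⟩
      rcases Int.even_or_odd' (m + n) with ⟨i, h | h⟩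
      · left
        exact ⟨(i, i - n), by simp only [hg, Prod.mk.injEq]; lia⟩
      · right
        exact ⟨(i, i - n), by simp only [hg', Prod.mk.injEq]; lia⟩
  exact (HasSum.add_isCompl hc (hi.hasSum_range_iff.2 (hf.comp_injective hi).hasSum)
    (hi'.hasSum_range_iff.2 (hf.comp_injective hi').hasSum)).tsum_eq

lemma thetaCoeff_add_mul_sub {p : ℂ} (h0 : p ≠ 0) (i j : ℤ) :
    thetaCoeff p (i + j) * thetaCoeff p (i - j) = p ^ (i * (i - 1)) * p ^ (j * j) := by
  have h : (i + j) * (i + j - 1) / 2 + (i - j) * (i - j - 1) / 2 = i * (i - 1) + j * j := by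
    obtain ⟨s, hs⟩ := Int.even_mul_pred_self (i + j)
    obtain ⟨t, ht⟩ := Int.even_mul_pred_self (i - j)
    have : 2 * (s + t) = 2 * (i * (i - 1) + j * j) := by linear_combination -hs - ht
    lia
  have h1 : ((-1 : ℂ) ^ (i + j)) * (-1) ^ (i - j) = 1 := by
    rw [← zpow_add₀ (by norm_num), show i + j + (i - j) = 2 * i by ring, zpow_mul]
    norm_num
  rw [← zpow_add₀ h0, ← h, zpow_add₀ h0, thetaCoeff, thetaCoeff]
  linear_combination p ^ ((i + j) * (i + j - 1) / 2) * p ^ ((i - j) * (i - j - 1) / 2) * h1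

/-- The even theta series `∑ p^{i²} x^{2i}`. -/
noncomputable def evenTheta (x p : ℂ) : ℂ := ∑' i : ℤ, p ^ (i * i) * x ^ (2 * i)

/-- The odd theta series `∑ p^{i(i+1)} x^{2i+1}`. -/
noncomputable def oddTheta (x p : ℂ) : ℂ := ∑' i : ℤ, p ^ (i * (i + 1)) * x ^ (2 * i + 1)

lemma jTheta_mul_jTheta_div {p : ℂ} (hp : ‖p‖ < 1) (h0 : p ≠ 0) {x y : ℂ} (hx : x ≠ 0)
    (hy : y ≠ 0) :
    qPochInf p p ^ 2 * (jTheta (x * y) p * jTheta (x / y) p) =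
      x * (oddTheta x p * evenTheta y p - evenTheta x p * oddTheta y p) := by
  have hf := summable_thetaCoeff hp h0 (mul_ne_zero hx hy)
  have hg := summable_thetaCoeff hp h0 (div_ne_zero hx hy)
  have hs := summable_mul_of_summable_norm hf hg
  have h1 := tsum_mul_tsum_of_summable_norm hf hg
  rw [tsum_int_prod_eq_add hs, tsum_thetaCoeff hp h0 (mul_ne_zero hx hy),
    tsum_thetaCoeff hp h0 (div_ne_zero hx hy)] at h1
  have e1 (i j : ℤ) : thetaCoeff p (i + j) * (x * y) ^ (i + j) *
      (thetaCoeff p (i - j) * (x / y) ^ (i - j)) =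
      (p ^ (i * (i - 1)) * x ^ (2 * i)) * (p ^ (j * j) * y ^ (2 * j)) := by
    have h := thetaCoeff_add_mul_sub h0 i j
    have h2 : (x * y) ^ (i + j) * (x / y) ^ (i - j) = x ^ (2 * i) * y ^ (2 * j) := by
      have h3 : (x * y) ^ (i + j) * (x / y) ^ (i - j) =
          x ^ (i + j) * x ^ (i - j) * (y ^ (i + j) / y ^ (i - j)) := by
        rw [mul_zpow, div_zpow]
        field_simp
      rw [h3, ← zpow_add₀ hx, ← zpow_sub₀ hy]
      ring_nf
    linear_combination (x * y) ^ (i + j) * (x / y) ^ (i - j) * h +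
      p ^ (i * (i - 1)) * p ^ (j * j) * h2
  have e2 (i j : ℤ) : thetaCoeff p (i + j + 1) * (x * y) ^ (i + j + 1) *
      (thetaCoeff p (i - j) * (x / y) ^ (i - j)) =
      -x * ((p ^ (i * i) * x ^ (2 * i)) * (p ^ (j * (j + 1)) * y ^ (2 * j + 1))) := by
    have h := e1 i j
    have h2 : p ^ (i * (i - 1)) * p ^ (j * j) * p ^ (i + j) = p ^ (i * i) * p ^ (j * (j + 1)) := by
      simp only [← zpow_add₀ h0]
      ring_nf
    rw [thetaCoeff_succ h0, zpow_add₀ (mul_ne_zero hx hy), zpow_add₀ hy, zpow_one, zpow_one]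
    linear_combination -p ^ (i + j) * (x * y) * h - x * x ^ (2 * i) * y * y ^ (2 * j) * h2
  have s1 : Summable fun z : ℤ × ℤ ↦ (p ^ (z.1 * (z.1 - 1)) * x ^ (2 * z.1)) *
      (p ^ (z.2 * z.2) * y ^ (2 * z.2)) := by
    refine (hs.comp_injective (i := fun z : ℤ × ℤ ↦ (z.1 + z.2, z.1 - z.2)) ?_).congr
      fun z ↦ e1 z.1 z.2
    rintro ⟨a, b⟩ ⟨c, d⟩ h
    simp only [Prod.mk.injEq] at h ⊢
    lia
  have s2 : Summable fun z : ℤ × ℤ ↦ -x * ((p ^ (z.1 * z.1) * x ^ (2 * z.1)) *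
      (p ^ (z.2 * (z.2 + 1)) * y ^ (2 * z.2 + 1))) := by
    refine (hs.comp_injective (i := fun z : ℤ × ℤ ↦ (z.1 + z.2 + 1, z.1 - z.2)) ?_).congr
      fun z ↦ e2 z.1 z.2
    rintro ⟨a, b⟩ ⟨c, d⟩ h
    simp only [Prod.mk.injEq] at h ⊢
    lia
  simp only [e1, e2] at h1
  rw [s1.tsum_prod, s2.tsum_prod] at h1
  simp only [tsum_mul_left, tsum_mul_right] at h1
  have h3 : ∑' i : ℤ, p ^ (i * (i - 1)) * x ^ (2 * i) = x * oddTheta x p := by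
    rw [oddTheta, ← tsum_mul_left, ← (Equiv.addRight (1 : ℤ)).tsum_eq]
    refine tsum_congr fun i ↦ ?_
    rw [Equiv.coe_addRight, show (i + 1) * (i + 1 - 1) = i * (i + 1) by ring,
      show 2 * (i + 1) = 2 * i + 1 + 1 by ring, zpow_add₀ hx _ 1, zpow_one]
    ring
  rw [h3] at h1
  simp only [oddTheta, evenTheta] at h1 ⊢
  linear_combination h1

/-- The Weierstrass addition formula. -/
lemma jTheta_addition {p : ℂ} (hp : ‖p‖ < 1) {x y u v : ℂ} (hx : x ≠ 0) (hy : y ≠ 0)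
    (hu : u ≠ 0) (hv : v ≠ 0) :
    jTheta (x * y) p * jTheta (x / y) p * (jTheta (u * v) p * jTheta (u / v) p) -
      jTheta (x * v) p * jTheta (x / v) p * (jTheta (u * y) p * jTheta (u / y) p) =
    u / y * (jTheta (y * v) p * jTheta (y / v) p * (jTheta (x * u) p * jTheta (x / u) p)) := by
  rcases eq_or_ne p 0 with rfl | h0
  · simp only [jTheta_zero_right]
    field_simp
    ring
  · have hP := qPochInf_self_ne_zero hp
    have key {x y : ℂ} (hx : x ≠ 0) (hy : y ≠ 0) : jTheta (x * y) p * jTheta (x / y) p =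
        x * (oddTheta x p * evenTheta y p - evenTheta x p * oddTheta y p) / qPochInf p p ^ 2 := by
      rw [← jTheta_mul_jTheta_div hp h0 hx hy]
      field_simp
    rw [key hx hy, key hu hv, key hx hv, key hu hy, key hy hv, key hx hu]
    field_simp
    ring

lemma ePoch_zero (a q p : ℂ) : ePoch a q p 0 = 1 := Finset.prod_range_zero _

lemma ePoch_succ (a q p : ℂ) (k : ℕ) :
    ePoch a q p (k + 1) = ePoch a q p k * jTheta (a * q ^ k) p :=
  Finset.prod_range_succ _ _

lemma ePoch_succ' (a q p : ℂ) (k : ℕ) :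
    ePoch a q p (k + 1) = jTheta a p * ePoch (a * q) q p k := by
  rw [ePoch, Finset.prod_range_succ', ePoch, mul_comm, pow_zero, mul_one]
  simp only [pow_succ', mul_assoc]

lemma ePoch_ne_zero {a q p : ℂ} {k : ℕ} :
    ePoch a q p k ≠ 0 ↔ ∀ j < k, jTheta (a * q ^ j) p ≠ 0 := by
  simp [ePoch, Finset.prod_ne_zero_iff]

/-- The `k`-th term of the very-well-poised series with parameters `a; b, c, d, e, f`. -/
noncomputable def wellPoisedTerm (q p a b c d e f : ℂ) (k : ℕ) : ℂ :=
  jTheta (a * q ^ (2 * k)) p / jTheta a p *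
    (ePoch a q p k * ePoch b q p k * ePoch c q p k * ePoch d q p k * ePoch e q p k *
      ePoch f q p k) /
    (ePoch q q p k * ePoch (q * a / b) q p k * ePoch (q * a / c) q p k * ePoch (q * a / d) q p k *
      ePoch (q * a / e) q p k * ePoch (q * a / f) q p k) * q ^ k

/-- The factor relating the series based at `a` to the one based at `a * q ^ 2`. -/
noncomputable def contiguousFactor (q p a b c d e f : ℂ) : ℂ :=
  q * jTheta (a * q ^ 2) p * jTheta (a * q) p * jTheta b p * jTheta c p * jTheta d p * (a / e) *
      jTheta (e * f / a) p * jTheta (e / f) p /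
    (jTheta (q * a / b) p * jTheta (q * a / c) p * jTheta (q * a / d) p * jTheta (q * a / e) p *
      jTheta (a / e) p * jTheta (a / f) p * jTheta (q * a / f) p)

lemma jTheta_wellPoised_addition {p : ℂ} (hp : ‖p‖ < 1) {a e f y : ℂ} (ha : a ≠ 0) (he : e ≠ 0)
    (hf : f ≠ 0) (hy : y ≠ 0) :
    jTheta (e * y) p * jTheta (a / e * y) p * (jTheta f p * jTheta (a / f) p) -
      jTheta (f * y) p * jTheta (a / f * y) p * (jTheta e p * jTheta (a / e) p) =
    a / e * (jTheta (e * f / a) p * jTheta (e / f) p * (jTheta (a * y) p * jTheta y p)) := by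
  obtain ⟨s, rfl⟩ : ∃ s, s ^ 2 = a := IsAlgClosed.exists_pow_nat_eq a two_pos
  have hs : s ≠ 0 := by rintro rfl; simp at ha
  have h := jTheta_addition hp (mul_ne_zero hs hy) (div_ne_zero he hs) hs (div_ne_zero hf hs)
  have e1 : s * y * (e / s) = e * y := by field_simp
  have e2 : s * y / (e / s) = s ^ 2 / e * y := by field_simp
  have e3 : s * (f / s) = f := by field_simp
  have e4 : s / (f / s) = s ^ 2 / f := by field_simp
  have e5 : s * y * (f / s) = f * y := by field_simp
  have e6 : s * y / (f / s) = s ^ 2 / f * y := by field_simp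
  have e7 : s * (e / s) = e := by field_simp
  have e8 : s / (e / s) = s ^ 2 / e := by field_simp
  have e9 : e / s * (f / s) = e * f / s ^ 2 := by field_simp
  have e10 : e / s / (f / s) = e / f := by field_simp
  have e11 : s * y * s = s ^ 2 * y := by ring
  have e12 : s * y / s = y := by field_simp
  rwa [e1, e2, e3, e4, e5, e6, e7, e8, e9, e10, e11, e12] at h

lemma jTheta_balanced_addition {p : ℂ} (hp : ‖p‖ < 1) {z b c d : ℂ} (hz : z ≠ 0) (hb : b ≠ 0)
    (hc : c ≠ 0) (hd : d ≠ 0) :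
    jTheta z p * jTheta (z / (b * c)) p * (jTheta (z / (b * d)) p * jTheta (z / (c * d)) p) -
      jTheta (z / b) p * jTheta (z / c) p * (jTheta (z / d) p * jTheta (z / (b * c * d)) p) =
    z / (b * c * d) *
      (jTheta c p * jTheta b p * (jTheta (z ^ 2 / (b * c * d)) p * jTheta d p)) := by
  obtain ⟨s, rfl⟩ : ∃ s, s ^ 2 = b := IsAlgClosed.exists_pow_nat_eq b two_pos
  obtain ⟨t, rfl⟩ : ∃ t, t ^ 2 = c := IsAlgClosed.exists_pow_nat_eq c two_pos
  have hs : s ≠ 0 := by rintro rfl; simp at hb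
  have ht : t ≠ 0 := by rintro rfl; simp at hc
  have hst := mul_ne_zero hs ht
  have h := jTheta_addition hp (div_ne_zero hz hst) hst (div_ne_zero hz (mul_ne_zero hst hd))
    (div_ne_zero ht hs)
  have e1 : z / (s * t) * (s * t) = z := by field_simp
  have e2 : z / (s * t) / (s * t) = z / (s ^ 2 * t ^ 2) := by field_simp
  have e3 : z / (s * t * d) * (t / s) = z / (s ^ 2 * d) := by field_simp
  have e4 : z / (s * t * d) / (t / s) = z / (t ^ 2 * d) := by field_simp
  have e5 : z / (s * t) * (t / s) = z / s ^ 2 := by field_simp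
  have e6 : z / (s * t) / (t / s) = z / t ^ 2 := by field_simp
  have e7 : z / (s * t * d) * (s * t) = z / d := by field_simp
  have e8 : z / (s * t * d) / (s * t) = z / (s ^ 2 * t ^ 2 * d) := by field_simp
  have e9 : s * t * (t / s) = t ^ 2 := by field_simp
  have e10 : s * t / (t / s) = s ^ 2 := by field_simp
  have e11 : z / (s * t) * (z / (s * t * d)) = z ^ 2 / (s ^ 2 * t ^ 2 * d) := by field_simp
  have e12 : z / (s * t) / (z / (s * t * d)) = d := by field_simp
  rwa [e1, e2, e3, e4, e5, e6, e7, e8, e9, e10, e11, e12] at h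

lemma wellPoised_cancel_fst (al ta Pa B C D E te tf F Pq B₁ C₁ D₁ tae Qe taey Qf taf y : ℂ)
    (h : taf ≠ 0) :
    al / ta * (Pa * B * C * D * (E * te) * (tf * F)) /
        (Pq * B₁ * C₁ * D₁ * (tae * (Qe / taey)) * Qf) * y =
      al / ta * (Pa * B * C * D * E * F) / (Pq * B₁ * C₁ * D₁ * Qe * Qf * tae * taf) * y *
        (te * taey * (tf * taf)) := by
  simp only [div_eq_mul_inv, mul_inv, inv_inv]
  linear_combination (-al * ta⁻¹ * Pa * B * C * D * E * te * tf * F * Pq⁻¹ * B₁⁻¹ * C₁⁻¹ * D₁⁻¹ *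
    tae⁻¹ * Qe⁻¹ * taey * Qf⁻¹ * y) * mul_inv_cancel₀ h

lemma wellPoised_cancel_snd (al ta Pa B C D E te tf F Pq B₁ C₁ D₁ tae Qe tafy Qf taf y : ℂ)
    (h : tae ≠ 0) :
    al / ta * (Pa * B * C * D * (te * E) * (F * tf)) /
        (Pq * B₁ * C₁ * D₁ * Qe * (taf * (Qf / tafy))) * y =
      al / ta * (Pa * B * C * D * E * F) / (Pq * B₁ * C₁ * D₁ * Qe * Qf * tae * taf) * y *
        (tf * tafy * (te * tae)) := by
  simp only [div_eq_mul_inv, mul_inv, inv_inv]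
  linear_combination (-al * ta⁻¹ * Pa * B * C * D * E * te * tf * F * Pq⁻¹ * B₁⁻¹ * C₁⁻¹ * D₁⁻¹ *
    taf⁻¹ * Qe⁻¹ * tafy * Qf⁻¹ * y) * mul_inv_cancel₀ h

lemma wellPoised_cancel_shift (al ta taq taqq Pa tay tb Pb tc Pc td Pd Pe Pf Pq ty tb₁ Pb₁ tc₁ Pc₁
    td₁ Pd₁ te₁ Pe₁ tf₁ Pf₁ te tf y q r u v : ℂ) (hta : ta ≠ 0) (htaqq : taqq ≠ 0)
    (htay : tay ≠ 0) (hty : ty ≠ 0) :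
    al / ta * (ta * taq * Pa / tay * (tb * Pb) * (tc * Pc) * (td * Pd) * Pe * Pf) /
        (Pq * ty * (tb₁ * Pb₁) * (tc₁ * Pc₁) * (td₁ * Pd₁) * (te₁ * Pe₁) * (tf₁ * Pf₁) *
          te * tf) * (y * q) * (r * (u * v * (tay * ty))) =
      q * taqq * taq * tb * tc * td * r * u * v / (tb₁ * tc₁ * td₁ * te₁ * te * tf * tf₁) *
        (al / taqq * (Pa * Pb * Pc * Pd * Pe * Pf) / (Pq * Pb₁ * Pc₁ * Pd₁ * Pe₁ * Pf₁) * y) := by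
  simp only [div_eq_mul_inv, mul_inv]
  linear_combination (al * taq * Pa * tb * Pb * tc * Pc * td * Pd * Pe * Pf * Pq⁻¹ * tb₁⁻¹ *
    Pb₁⁻¹ * tc₁⁻¹ * Pc₁⁻¹ * td₁⁻¹ * Pd₁⁻¹ * te₁⁻¹ * Pe₁⁻¹ * tf₁⁻¹ * Pf₁⁻¹ * te⁻¹ * tf⁻¹ * y * q *
    r * u * v) * (tay * tay⁻¹ * ty * ty⁻¹ * mul_inv_cancel₀ hta + ty * ty⁻¹ * mul_inv_cancel₀ htay +
      mul_inv_cancel₀ hty - mul_inv_cancel₀ htaqq)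

lemma wellPoisedTerm_contiguous {p q a e f : ℂ} (b c d : ℂ) (hp : ‖p‖ < 1) (hq : q ≠ 0)
    (ha : a ≠ 0) (he : e ≠ 0) (hf : f ≠ 0) (hA : ∀ j : ℕ, jTheta (a * q ^ j) p ≠ 0)
    (hE : ∀ j : ℕ, jTheta (a / e * q ^ j) p ≠ 0) (hF : ∀ j : ℕ, jTheta (a / f * q ^ j) p ≠ 0)
    (k : ℕ) (hk : jTheta (q * q ^ k) p ≠ 0) :
    wellPoisedTerm q p a b c d (e * q) f (k + 1) - wellPoisedTerm q p a b c d e (f * q) (k + 1) =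
      contiguousFactor q p a b c d e f *
        wellPoisedTerm q p (a * q ^ 2) (b * q) (c * q) (d * q) (e * q) (f * q) k := by
  have W := jTheta_wellPoised_addition hp ha he hf (y := q * q ^ k)
    (mul_ne_zero hq (pow_ne_zero k hq))
  have cancel (g : ℂ) : q * a / (g * q) = a / g := by field_simp
  have shift (g : ℂ) : q * (a * q ^ 2) / (g * q) = q * a / g * q := by field_simp
  have shift0 : a * q ^ (2 * (k + 1)) = a * q ^ 2 * q ^ (2 * k) := by ring
  have hEk : jTheta (a / e * (q * q ^ k)) p ≠ 0 := by simpa [pow_succ'] using hE (k + 1)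
  have hFk : jTheta (a / f * (q * q ^ k)) p ≠ 0 := by simpa [pow_succ'] using hF (k + 1)
  have hAk : jTheta (a * (q * q ^ k)) p ≠ 0 := by simpa [pow_succ'] using hA (k + 1)
  have hE0 : jTheta (a / e) p ≠ 0 := by simpa using hE 0
  have hF0 : jTheta (a / f) p ≠ 0 := by simpa using hF 0
  have hA0 : jTheta a p ≠ 0 := by simpa using hA 0
  have hA2 : jTheta (a * q ^ 2) p ≠ 0 := hA 2
  have hPa : ePoch a q p (k + 1) =
      jTheta a p * jTheta (a * q) p * ePoch (a * q ^ 2) q p k / jTheta (a * (q * q ^ k)) p := by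
    rw [eq_div_iff hAk, ← pow_succ', ← ePoch_succ, ePoch_succ', ePoch_succ', sq]
    ring_nf
  have hP (g : ℂ) (hg : jTheta (a / g * (q * q ^ k)) p ≠ 0) : ePoch (q * a / g) q p k =
      jTheta (q * a / g) p * ePoch (q * a / g * q) q p k / jTheta (a / g * (q * q ^ k)) p := by
    rw [eq_div_iff hg, ← ePoch_succ', ePoch_succ]
    ring_nf
  have hqa (g : ℂ) : a / g * q = q * a / g := by ring
  have hshape (g : ℂ) : g * q * q ^ k = g * (q * q ^ k) := by ring
  set K : ℂ := jTheta (a * q ^ 2 * q ^ (2 * k)) p / jTheta a p *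
    (jTheta a p * jTheta (a * q) p * ePoch (a * q ^ 2) q p k / jTheta (a * (q * q ^ k)) p *
      (jTheta b p * ePoch (b * q) q p k) * (jTheta c p * ePoch (c * q) q p k) *
      (jTheta d p * ePoch (d * q) q p k) * ePoch (e * q) q p k * ePoch (f * q) q p k) /
    (ePoch q q p k * jTheta (q * q ^ k) p *
      (jTheta (q * a / b) p * ePoch (q * a / b * q) q p k) *
      (jTheta (q * a / c) p * ePoch (q * a / c * q) q p k) *
      (jTheta (q * a / d) p * ePoch (q * a / d * q) q p k) *
      (jTheta (q * a / e) p * ePoch (q * a / e * q) q p k) *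
      (jTheta (q * a / f) p * ePoch (q * a / f * q) q p k) *
      jTheta (a / e) p * jTheta (a / f) p) * q ^ (k + 1) with hK
  have h1 : wellPoisedTerm q p a b c d (e * q) f (k + 1) =
      K * (jTheta (e * (q * q ^ k)) p * jTheta (a / e * (q * q ^ k)) p *
        (jTheta f p * jTheta (a / f) p)) := by
    rw [wellPoisedTerm, cancel, shift0, hPa, ePoch_succ' b, ePoch_succ' c, ePoch_succ' d,
      ePoch_succ (e * q), ePoch_succ' f, ePoch_succ q, ePoch_succ' (q * a / b),
      ePoch_succ' (q * a / c), ePoch_succ' (q * a / d), ePoch_succ' (a / e),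
      ePoch_succ' (q * a / f), hqa, hP e hEk, hshape, hK]
    exact wellPoised_cancel_fst _ _ _ _ _ _ _ _ _ _ _ _ _ _ _ _ _ _ _ _ hF0
  have h2 : wellPoisedTerm q p a b c d e (f * q) (k + 1) =
      K * (jTheta (f * (q * q ^ k)) p * jTheta (a / f * (q * q ^ k)) p *
        (jTheta e p * jTheta (a / e) p)) := by
    rw [wellPoisedTerm, cancel, shift0, hPa, ePoch_succ' b, ePoch_succ' c, ePoch_succ' d,
      ePoch_succ (f * q), ePoch_succ' e, ePoch_succ q, ePoch_succ' (q * a / b),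
      ePoch_succ' (q * a / c), ePoch_succ' (q * a / d), ePoch_succ' (a / f),
      ePoch_succ' (q * a / e), hqa, hP f hFk, hshape, hK]
    exact wellPoised_cancel_snd _ _ _ _ _ _ _ _ _ _ _ _ _ _ _ _ _ _ _ _ hE0
  rw [h1, h2, ← mul_sub, W, wellPoisedTerm, contiguousFactor]
  simp only [shift]
  rw [hK, pow_succ]
  exact wellPoised_cancel_shift _ _ _ _ _ _ _ _ _ _ _ _ _ _ _ _ _ _ _ _ _ _ _ _ _ _ _ _ _ _ _ _ _
    hA0 hA2 hAk hk

/-- The closed form of the elliptic Jackson sum. -/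
noncomputable def jacksonProduct (q p a b c d : ℂ) (n : ℕ) : ℂ :=
  ePoch (q * a) q p n * ePoch (q * a / (b * c)) q p n * ePoch (q * a / (b * d)) q p n *
      ePoch (q * a / (c * d)) q p n /
    (ePoch (q * a / b) q p n * ePoch (q * a / c) q p n * ePoch (q * a / d) q p n *
      ePoch (q * a / (b * c * d)) q p n)

lemma jackson_cancel_step (A B C D A₁ B₁ C₁ D₁ w x y z w₁ x₁ y₁ z₁ : ℂ) :
    A * w * (B * x) * (C * y) * (D * z) / (A₁ * w₁ * (B₁ * x₁) * (C₁ * y₁) * (D₁ * z₁)) =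
      A * B * C * D / (A₁ * B₁ * C₁ * D₁) * (w * x * (y * z)) / (w₁ * x₁ * (y₁ * z₁)) := by
  simp only [div_eq_mul_inv, mul_inv]
  ring

lemma jackson_cancel_shift (ta taqq A tz tzq B C D tb B₁ zb tc C₁ zc td D₁ zd M tm tm₀ w b c d v t
    q m : ℂ) (hw : w = q * m) (hw₀ : w ≠ 0) (hzb : zb ≠ 0) (hzc : zc ≠ 0) (hzd : zd ≠ 0) :
    ta * taqq * A / (tz * tzq) * B * C * D /
        (tb * B₁ / zb * (tc * C₁ / zc) * (td * D₁ / zd) * (M * tm / tm₀)) *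
        (w * (c * b * (v * d))) / (zb * zc * (zd * t)) =
      q * taqq * ta * b * c * d * w⁻¹ * tm₀ * v /
        (tb * tc * td * (-m⁻¹ * tm) * (-w⁻¹ * t) * tz * tzq) *
        (A * B * C * D / (B₁ * C₁ * D₁ * M)) := by
  simp only [div_eq_mul_inv, mul_inv, inv_inv, inv_neg]
  linear_combination (ta * taqq * A * tz⁻¹ * tzq⁻¹ * B * C * D * tb⁻¹ * B₁⁻¹ * tc⁻¹ * C₁⁻¹ * td⁻¹ *
    D₁⁻¹ * M⁻¹ * tm⁻¹ * tm₀ * c * b * v * d * t⁻¹) * (hw + w * zc * zc⁻¹ * zd * zd⁻¹ *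
      mul_inv_cancel₀ hzb + w * zd * zd⁻¹ * mul_inv_cancel₀ hzc + w * mul_inv_cancel₀ hzd -
      q * m * mul_inv_cancel₀ hw₀)

lemma jacksonProduct_succ_sub {p q a b c d : ℂ} (hp : ‖p‖ < 1) (hq : q ≠ 0) (ha : a ≠ 0)
    (hb : b ≠ 0) (hc : c ≠ 0) (hd : d ≠ 0) (n : ℕ) (hA : ∀ j : ℕ, jTheta (a * q ^ j) p ≠ 0)
    (hB : ∀ j : ℕ, jTheta (a / b * q ^ j) p ≠ 0) (hC : ∀ j : ℕ, jTheta (a / c * q ^ j) p ≠ 0)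
    (hD : ∀ j : ℕ, jTheta (a / d * q ^ j) p ≠ 0)
    (hM : ∀ j : ℕ, jTheta (a / (b * c * d) * q ^ j) p ≠ 0) :
    jacksonProduct q p a b c d (n + 1) - jacksonProduct q p a b c d n =
      contiguousFactor q p a b c d (q ^ (n + 1) * a ^ 2 / (b * c * d)) (q ^ (n + 1))⁻¹ *
        jacksonProduct q p (a * q ^ 2) (b * q) (c * q) (d * q) n := by
  have hqn := pow_ne_zero n hq
  set z : ℂ := a * (q * q ^ n) with hz
  have hz0 : z ≠ 0 := mul_ne_zero ha (mul_ne_zero hq hqn)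
  have W := jTheta_balanced_addition hp hz0 hb hc hd
  have hZ : jTheta z p ≠ 0 := by simpa [pow_succ'] using hA (n + 1)
  have hZq : jTheta (z * q) p ≠ 0 := by
    have := hA (n + 2)
    rwa [show a * q ^ (n + 2) = z * q by rw [hz]; ring] at this
  have hZg (g : ℂ) (h : ∀ j : ℕ, jTheta (a / g * q ^ j) p ≠ 0) : jTheta (z / g) p ≠ 0 := by
    have := h (n + 1)
    rwa [show a / g * q ^ (n + 1) = z / g by rw [hz]; ring] at this
  have hZb := hZg b hB
  have hZc := hZg c hC
  have hZd := hZg d hD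
  have hZm := hZg _ hM
  have hM0 : jTheta (a / (b * c * d)) p ≠ 0 := by simpa using hM 0
  have hstep (g : ℂ) : q * a / g * q ^ n = z / g := by rw [hz]; ring
  have hstep0 : q * a * q ^ n = z := by rw [hz]; ring
  have hPa : ePoch (q * a) q p n =
      jTheta (q * a) p * jTheta (a * q ^ 2) p * ePoch (q * (a * q ^ 2)) q p n /
        (jTheta z p * jTheta (z * q) p) := by
    rw [eq_div_iff (mul_ne_zero hZ hZq)]
    have h := ePoch_succ (q * a) q p (n + 1)
    rw [ePoch_succ' (q * a) q p (n + 1), ePoch_succ' (q * a * q) q p n, ePoch_succ (q * a) q p n,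
      hstep0, show q * a * q ^ (n + 1) = z * q by rw [hz]; ring,
      show q * a * q = a * q ^ 2 by ring, show a * q ^ 2 * q = q * (a * q ^ 2) by ring] at h
    linear_combination -h
  have hP (g : ℂ) (h : jTheta (z / g) p ≠ 0) : ePoch (q * a / g) q p n =
      jTheta (q * a / g) p * ePoch (q * a / g * q) q p n / jTheta (z / g) p := by
    rw [eq_div_iff h, ← ePoch_succ', ePoch_succ, hstep]
  have hPm : ePoch (q * a / (b * c * d)) q p n = ePoch (a / (b * c * d)) q p n *
      jTheta (a / (b * c * d) * q ^ n) p / jTheta (a / (b * c * d)) p := by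
    rw [eq_div_iff hM0, ← ePoch_succ, ePoch_succ']
    ring_nf
  have e1 (g : ℂ) : q * (a * q ^ 2) / (g * q) = q * a / g * q := by field_simp
  have e2 (g h : ℂ) : q * (a * q ^ 2) / (g * q * (h * q)) = q * a / (g * h) := by field_simp
  have e3 : q * (a * q ^ 2) / (b * q * (c * q) * (d * q)) = a / (b * c * d) := by field_simp
  have c1 : a / (q ^ (n + 1) * a ^ 2 / (b * c * d)) = (z / (b * c * d))⁻¹ := by
    rw [hz]; field_simp; ring
  have c2 : q * a / (q ^ (n + 1) * a ^ 2 / (b * c * d)) = (a / (b * c * d) * q ^ n)⁻¹ := by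
    field_simp; ring
  have c3 : a / (q ^ (n + 1))⁻¹ = z := by rw [hz]; field_simp; ring
  have c4 : q * a / (q ^ (n + 1))⁻¹ = z * q := by rw [hz]; field_simp; ring
  have c5 : q ^ (n + 1) * a ^ 2 / (b * c * d) * (q ^ (n + 1))⁻¹ / a = a / (b * c * d) := by
    field_simp
  have c6 : q ^ (n + 1) * a ^ 2 / (b * c * d) / (q ^ (n + 1))⁻¹ = z ^ 2 / (b * c * d) := by
    rw [hz]; field_simp; ring
  have hbcd : b * c * d ≠ 0 := mul_ne_zero (mul_ne_zero hb hc) hd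
  have h1 : jacksonProduct q p a b c d (n + 1) = jacksonProduct q p a b c d n *
      (jTheta z p * jTheta (z / (b * c)) p *
          (jTheta (z / (b * d)) p * jTheta (z / (c * d)) p)) /
        (jTheta (z / b) p * jTheta (z / c) p *
          (jTheta (z / d) p * jTheta (z / (b * c * d)) p)) := by
    rw [jacksonProduct, jacksonProduct]
    simp only [ePoch_succ, hstep, hstep0]
    exact jackson_cancel_step _ _ _ _ _ _ _ _ _ _ _ _ _ _ _ _
  have h2 : jacksonProduct q p a b c d (n + 1) - jacksonProduct q p a b c d n =
      jacksonProduct q p a b c d n * (z / (b * c * d) *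
        (jTheta c p * jTheta b p * (jTheta (z ^ 2 / (b * c * d)) p * jTheta d p))) /
        (jTheta (z / b) p * jTheta (z / c) p *
          (jTheta (z / d) p * jTheta (z / (b * c * d)) p)) := by
    rw [h1, ← W, mul_sub, sub_div,
      mul_div_cancel_right₀ _ (mul_ne_zero (mul_ne_zero hZb hZc) (mul_ne_zero hZd hZm))]
  rw [h2, contiguousFactor, c1, c2, c3, c4, c5, c6,
    jTheta_inv hp (div_ne_zero hz0 hbcd),
    jTheta_inv hp (mul_ne_zero (div_ne_zero ha hbcd) hqn), jacksonProduct, jacksonProduct]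
  simp only [e1, e2, e3]
  rw [hPa, hP b hZb, hP c hZc, hP d hZd, hPm]
  have hzz : z / (b * c * d) = q * (a / (b * c * d) * q ^ n) := by rw [hz]; ring
  rw [mul_comm a q]
  exact jackson_cancel_shift _ _ _ _ _ _ _ _ _ _ _ _ _ _ _ _ _ _ _ _ _ _ _ _ _ _ _ _ hzz
    (div_ne_zero hz0 hbcd) hZb hZc hZd

lemma wellPoisedTerm_zero {q p a : ℂ} (b c d e f : ℂ) (ha : jTheta a p ≠ 0) :
    wellPoisedTerm q p a b c d e f 0 = 1 := by
  simp [wellPoisedTerm, ePoch_zero, ha]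

lemma ePoch_inv_pow_succ {p q : ℂ} (hp : ‖p‖ < 1) (hq : q ≠ 0) (n : ℕ) :
    ePoch (q ^ n)⁻¹ q p (n + 1) = 0 := by
  rw [ePoch_succ, inv_mul_cancel₀ (pow_ne_zero n hq), jTheta_one hp, mul_zero]

theorem sum_wellPoisedTerm_of_generic {p q : ℂ} (hp : ‖p‖ < 1) (hq : q ≠ 0) (n : ℕ) {a b c d : ℂ}
    (ha : a ≠ 0) (hb : b ≠ 0) (hc : c ≠ 0) (hd : d ≠ 0)
    (hQ : ∀ j < n, jTheta (q * q ^ j) p ≠ 0)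
    (hA : ∀ j : ℤ, jTheta (a * q ^ j) p ≠ 0) (hB : ∀ j : ℤ, jTheta (a / b * q ^ j) p ≠ 0)
    (hC : ∀ j : ℤ, jTheta (a / c * q ^ j) p ≠ 0) (hD : ∀ j : ℤ, jTheta (a / d * q ^ j) p ≠ 0)
    (hM : ∀ j : ℤ, jTheta (a / (b * c * d) * q ^ j) p ≠ 0) :
    ∑ k ∈ Finset.range (n + 1),
        wellPoisedTerm q p a b c d (q ^ (n + 1) * a ^ 2 / (b * c * d)) (q ^ n)⁻¹ k =
      jacksonProduct q p a b c d n := by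
  induction n generalizing a b c d with
  | zero =>
    rw [Finset.sum_range_one, wellPoisedTerm_zero _ _ _ _ _ (by simpa using hA 0)]
    simp [jacksonProduct, ePoch_zero]
  | succ n ih =>
    have hbcd : b * c * d ≠ 0 := mul_ne_zero (mul_ne_zero hb hc) hd
    have hQ' : ∀ j < n, jTheta (q * q ^ j) p ≠ 0 := fun j hj ↦ hQ j (hj.trans n.lt_succ_self)
    have nat (x : ℂ) (h : ∀ j : ℤ, jTheta (x * q ^ j) p ≠ 0) (j : ℕ) :
        jTheta (x * q ^ j) p ≠ 0 := by simpa using h j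
    have shift (x y : ℂ) (i : ℤ) (hy : y = x * q ^ i)
        (h : ∀ j : ℤ, jTheta (x * q ^ j) p ≠ 0) (j : ℤ) : jTheta (y * q ^ j) p ≠ 0 := by
      rw [hy, mul_assoc, ← zpow_add₀ hq]
      exact h _
    set e : ℂ := q ^ (n + 1) * a ^ 2 / (b * c * d) with he
    set f : ℂ := (q ^ (n + 1))⁻¹ with hf
    have he0 : e ≠ 0 := div_ne_zero (mul_ne_zero (pow_ne_zero _ hq) (pow_ne_zero 2 ha)) hbcd
    have hf0 : f ≠ 0 := inv_ne_zero (pow_ne_zero _ hq)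
    have hfq : f * q = (q ^ n)⁻¹ := by rw [hf]; field_simp; ring
    have heq : q ^ (n + 1 + 1) * a ^ 2 / (b * c * d) = e * q := by rw [he]; ring
    have heq' : q ^ (n + 1) * (a * q ^ 2) ^ 2 / (b * q * (c * q) * (d * q)) = e * q := by
      rw [he]; field_simp
    have hF (j : ℕ) : jTheta (a / f * q ^ j) p ≠ 0 := by
      have := nat a hA (n + 1 + j)
      rwa [show a * q ^ (n + 1 + j) = a / f * q ^ j by rw [hf, div_inv_eq_mul, pow_add, mul_assoc]]
        at this
    have hE (j : ℕ) : jTheta (a / e * q ^ j) p ≠ 0 := by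
      have h := hM ((n + 1 : ℕ) - (j : ℤ))
      have hx : a / e * q ^ j = (a / (b * c * d) * q ^ (((n + 1 : ℕ) : ℤ) - (j : ℤ)))⁻¹ := by
        rw [he, zpow_sub₀ hq, zpow_natCast, zpow_natCast]
        field_simp
      rw [hx, jTheta_inv hp (mul_ne_zero (div_ne_zero ha hbcd) (zpow_ne_zero _ hq))]
      exact mul_ne_zero (neg_ne_zero.2 (inv_ne_zero
        (mul_ne_zero (div_ne_zero ha hbcd) (zpow_ne_zero _ hq)))) h
    have ih₁ := ih ha hb hc hd hQ' hA hB hC hD hM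
    have ih₂ := ih (a := a * q ^ 2) (b := b * q) (c := c * q) (d := d * q)
      (mul_ne_zero ha (pow_ne_zero 2 hq)) (mul_ne_zero hb hq) (mul_ne_zero hc hq)
      (mul_ne_zero hd hq) hQ' (shift a _ 2 (by norm_cast) hA)
      (shift (a / b) _ 1 (by field_simp) hB)
      (shift (a / c) _ 1 (by field_simp) hC)
      (shift (a / d) _ 1 (by field_simp) hD)
      (shift (a / (b * c * d)) _ (-1) (by field_simp) hM)
    rw [heq', ← hfq] at ih₂
    rw [← he, ← hfq] at ih₁
    have hlast : wellPoisedTerm q p a b c d e (f * q) (n + 1) = 0 := by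
      rw [wellPoisedTerm, hfq, ePoch_inv_pow_succ hp hq]
      simp
    have hdiff := jacksonProduct_succ_sub hp hq ha hb hc hd n (nat a hA) (nat _ hB) (nat _ hC)
      (nat _ hD) (nat _ hM)
    rw [← he, ← hf, ← ih₂, ← ih₁, sub_eq_iff_eq_add, Finset.mul_sum] at hdiff
    have hA0 : jTheta a p ≠ 0 := by simpa using hA 0
    have hsum : ∑ k ∈ Finset.range (n + 1), wellPoisedTerm q p a b c d e (f * q) k =
        ∑ k ∈ Finset.range (n + 1), wellPoisedTerm q p a b c d e (f * q) (k + 1) + 1 := by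
      rw [← wellPoisedTerm_zero b c d e (f * q) hA0, ← Finset.sum_range_succ',
        Finset.sum_range_succ _ (n + 1), hlast, add_zero]
    rw [heq, hdiff, hsum, Finset.sum_range_succ', wellPoisedTerm_zero _ _ _ _ _ hA0, ← add_assoc,
      ← Finset.sum_add_distrib]
    congr 1
    refine Finset.sum_congr rfl fun k hk ↦ ?_
    rw [← wellPoisedTerm_contiguous b c d hp hq ha he0 hf0 (nat a hA) hE hF k
      (hQ k (Finset.mem_range.1 hk)), sub_add_cancel]

lemma dense_generic_parameters {p q : ℂ} (hp : ‖p‖ < 1) (hq : q ≠ 0) {T : Set ℂ}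
    (hT : T.Countable) (hT₀ : ∀ t ∈ T, t ≠ 0) :
    Dense {a : ℂ | a ≠ 0 ∧ ∀ t ∈ T, ∀ j : ℤ, jTheta (a * t * q ^ j) p ≠ 0} := by
  have hZ : ({0} ∪ ⋃ t ∈ T, ⋃ j : ℤ,
      (fun x ↦ x / (t * q ^ j)) '' {x | x ≠ 0 ∧ jTheta x p = 0} : Set ℂ).Countable :=
    (Set.countable_singleton 0).union (hT.biUnion fun t _ ↦ Set.countable_iUnion fun j ↦
      (countable_jTheta_zeros hp).image _)
  refine (hZ.dense_compl ℂ).mono fun a ha ↦ ?_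
  simp only [Set.mem_compl_iff, Set.mem_union, Set.mem_singleton_iff, Set.mem_iUnion, not_or,
    not_exists] at ha
  refine ⟨ha.1, fun t ht j h ↦ ha.2 t ht j ⟨a * t * q ^ j, ⟨?_, h⟩, ?_⟩⟩
  · exact mul_ne_zero (mul_ne_zero ha.1 (hT₀ t ht)) (zpow_ne_zero j hq)
  · have := hT₀ t ht
    have := zpow_ne_zero j hq
    field_simp

lemma ContinuousAt.ePoch {p q : ℂ} (hp : ‖p‖ < 1) (hq : q ≠ 0) {g : ℂ → ℂ} {x : ℂ}
    (hg : ContinuousAt g x) (hx : g x ≠ 0) (k : ℕ) : ContinuousAt (fun y ↦ ePoch (g y) q p k) x := by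
  unfold _root_.ePoch
  refine tendsto_finsetProd _ fun j _ ↦ ?_
  exact (continuousAt_jTheta hp (mul_ne_zero hx (pow_ne_zero j hq))).comp
    (f := fun y ↦ g y * q ^ j) (hg.mul continuousAt_const)

lemma ePoch_ne_zero_of_le {a q p : ℂ} {k n : ℕ} (hkn : k ≤ n) (h : ePoch a q p n ≠ 0) :
    ePoch a q p k ≠ 0 :=
  ePoch_ne_zero.2 fun j hj ↦ ePoch_ne_zero.1 h j (hj.trans_le hkn)

/-- The elliptic analogue of Jackson's `₈W₇` summation:
`₁₀V₉(a; b, c, d, q^{n+1}a²/(bcd), q^{−n}; q, p)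
  = ((qa;q,p)_n (qa/(bc);q,p)_n (qa/(bd);q,p)_n (qa/(cd);q,p)_n)
    / ((qa/b;q,p)_n (qa/c;q,p)_n (qa/d;q,p)_n (qa/(bcd);q,p)_n)`,
written out explicitly; `‖p‖ < 1`, `0 < ‖q‖ < 1`, `a,b,c,d ≠ 0`, and no theta factor
in any denominator vanishes. -/
theorem elliptic_jackson_summation (n : ℕ) (p q a b c d : ℂ)
    (hp : ‖p‖ < 1) (hq0 : 0 < ‖q‖) (hq1 : ‖q‖ < 1)
    (ha : a ≠ 0) (hb : b ≠ 0) (hc : c ≠ 0) (hd : d ≠ 0)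
    (h0 : jTheta a p ≠ 0)
    (h1 : ePoch (q * a / b) q p n ≠ 0) (h2 : ePoch (q * a / c) q p n ≠ 0)
    (h3 : ePoch (q * a / d) q p n ≠ 0)
    (h4 : ePoch (q ^ (-(n : ℤ)) * b * c * d / a) q p n ≠ 0)
    (h5 : ePoch (q ^ (n + 1) * a) q p n ≠ 0)
    (h6 : ePoch q q p n ≠ 0)
    (h7 : ePoch (q * a / (b * c * d)) q p n ≠ 0) :
    ∑ k ∈ Finset.range (n + 1),
        jTheta (a * q ^ (2 * k)) p / jTheta a p *
          (ePoch a q p k * ePoch b q p k * ePoch c q p k * ePoch d q p k *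
            ePoch (q ^ (n + 1) * a ^ 2 / (b * c * d)) q p k *
            ePoch (q ^ (-(n : ℤ))) q p k) /
          (ePoch q q p k * ePoch (q * a / b) q p k * ePoch (q * a / c) q p k *
            ePoch (q * a / d) q p k * ePoch (q ^ (-(n : ℤ)) * b * c * d / a) q p k *
            ePoch (q ^ (n + 1) * a) q p k) * q ^ k
      = ePoch (q * a) q p n * ePoch (q * a / (b * c)) q p n *
          ePoch (q * a / (b * d)) q p n * ePoch (q * a / (c * d)) q p n /
          (ePoch (q * a / b) q p n * ePoch (q * a / c) q p n * ePoch (q * a / d) q p n *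
            ePoch (q * a / (b * c * d)) q p n) := by
  have hq : q ≠ 0 := norm_pos_iff.1 hq0
  have hqn (m : ℕ) : q ^ m ≠ 0 := pow_ne_zero m hq
  have hdense := dense_generic_parameters hp hq
    (T := {1, b⁻¹, c⁻¹, d⁻¹, (b * c * d)⁻¹}) (Set.toFinite _).countable (by simp [hb, hc, hd])
  have := mem_closure_iff_nhdsWithin_neBot.1 (hdense a)
  have hθ (m : ℕ) : ContinuousAt (fun y ↦ jTheta (y * q ^ m) p) a :=
    (continuousAt_jTheta hp (mul_ne_zero ha (hqn m))).comp (f := fun y ↦ y * q ^ m) (by fun_prop)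
  have hz : q ^ (-(n : ℤ)) ≠ 0 := zpow_ne_zero _ hq
  have cb := fun k ↦ ContinuousAt.ePoch hp hq (x := a) (g := fun x ↦ q * x / b) (by fun_prop)
    (by simp [*]) k
  have cc := fun k ↦ ContinuousAt.ePoch hp hq (x := a) (g := fun x ↦ q * x / c) (by fun_prop)
    (by simp [*]) k
  have cd := fun k ↦ ContinuousAt.ePoch hp hq (x := a) (g := fun x ↦ q * x / d) (by fun_prop)
    (by simp [*]) k
  refine tendsto_nhds_unique_of_eventuallyEq
    (f := fun x ↦ ∑ k ∈ Finset.range (n + 1), jTheta (x * q ^ (2 * k)) p / jTheta x p *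
          (ePoch x q p k * ePoch b q p k * ePoch c q p k * ePoch d q p k *
            ePoch (q ^ (n + 1) * x ^ 2 / (b * c * d)) q p k *
            ePoch (q ^ (-(n : ℤ))) q p k) /
          (ePoch q q p k * ePoch (q * x / b) q p k * ePoch (q * x / c) q p k *
            ePoch (q * x / d) q p k * ePoch (q ^ (-(n : ℤ)) * b * c * d / x) q p k *
            ePoch (q ^ (n + 1) * x) q p k) * q ^ k)
    (g := fun x ↦ jacksonProduct q p x b c d n)
    (l := 𝓝[{x : ℂ | x ≠ 0 ∧ ∀ t ∈ ({1, b⁻¹, c⁻¹, d⁻¹, (b * c * d)⁻¹} : Set ℂ), ∀ j : ℤ,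
      jTheta (x * t * q ^ j) p ≠ 0}] a) ?_ ?_ ?_
  · refine Tendsto.mono_left ?_ nhdsWithin_le_nhds
    refine tendsto_finsetSum _ fun k hk ↦ ?_
    have hkn : k ≤ n := Nat.lt_succ_iff.1 (Finset.mem_range.1 hk)
    have ca := ContinuousAt.ePoch hp hq (x := a) (g := fun x ↦ x) (by fun_prop) ha k
    have ce := ContinuousAt.ePoch hp hq (x := a) (g := fun x ↦ q ^ (n + 1) * x ^ 2 / (b * c * d))
      (by fun_prop) (by simp [*]) k
    have ce' := ContinuousAt.ePoch hp hq (x := a) (g := fun x ↦ q ^ (-(n : ℤ)) * b * c * d / x)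
      (by fun_prop (disch := exact ha)) (by simp [*]) k
    have cf' := ContinuousAt.ePoch hp hq (x := a) (g := fun x ↦ q ^ (n + 1) * x)
      (by fun_prop) (by simp [*]) k
    have ne := fun {x : ℂ} ↦ ePoch_ne_zero_of_le (a := x) (q := q) (p := p) hkn
    exact ((((hθ _).div (continuousAt_jTheta hp ha) h0).mul
      (((((ca.mul continuousAt_const).mul continuousAt_const).mul continuousAt_const).mul ce).mul
        continuousAt_const)).div
      (((((continuousAt_const.mul (cb k)).mul (cc k)).mul (cd k)).mul ce').mul cf')
      (mul_ne_zero (mul_ne_zero (mul_ne_zero (mul_ne_zero (mul_ne_zero (ne h6) (ne h1)) (ne h2))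
        (ne h3)) (ne h4)) (ne h5))).mul continuousAt_const
  · refine Tendsto.mono_left ?_ nhdsWithin_le_nhds
    have ca := ContinuousAt.ePoch hp hq (x := a) (g := fun x ↦ q * x) (by fun_prop)
      (by simp [*]) n
    have cbc := ContinuousAt.ePoch hp hq (x := a) (g := fun x ↦ q * x / (b * c)) (by fun_prop)
      (by simp [*]) n
    have cbd := ContinuousAt.ePoch hp hq (x := a) (g := fun x ↦ q * x / (b * d)) (by fun_prop)
      (by simp [*]) n
    have ccd := ContinuousAt.ePoch hp hq (x := a) (g := fun x ↦ q * x / (c * d)) (by fun_prop)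
      (by simp [*]) n
    have cbcd := ContinuousAt.ePoch hp hq (x := a) (g := fun x ↦ q * x / (b * c * d))
      (by fun_prop) (by simp [*]) n
    exact (((ca.mul cbc).mul cbd).mul ccd).div ((((cb n).mul (cc n)).mul (cd n)).mul cbcd)
      (mul_ne_zero (mul_ne_zero (mul_ne_zero h1 h2) h3) h7)
  · filter_upwards [self_mem_nhdsWithin] with x ⟨hx, hgen⟩
    simp only [Set.mem_insert_iff, Set.mem_singleton_iff, forall_eq_or_imp, forall_eq, mul_one,
      ← div_eq_mul_inv] at hgen
    obtain ⟨hA, hB, hC, hD, hM⟩ := hgen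
    rw [← sum_wellPoisedTerm_of_generic hp hq n hx hb hc hd (ePoch_ne_zero.1 h6) hA hB hC hD hM]
    refine Finset.sum_congr rfl fun k _ ↦ ?_
    have h₁ : q * x / (q ^ (n + 1) * x ^ 2 / (b * c * d)) = q ^ (-(n : ℤ)) * b * c * d / x := by
      rw [zpow_neg, zpow_natCast]
      field_simp
      ring
    have h₂ : q * x / (q ^ n)⁻¹ = q ^ (n + 1) * x := by
      field_simp
      ring
    rw [wellPoisedTerm, h₁, h₂, zpow_neg, zpow_natCast]
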